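/- Existence of filtered Stanley decomposition: Let K be an infinite field and M a finitely generated graded module over K[x_1,…,x_n]. Then, after a suitable (generic) linear change of coordinates, M admits a decomposition as a graded K-vector space M = ⊕_{i=0}^n N_i where each N_i ⊆ M is a free finitely generated graded module over R_i = K[x_{n-i+1},…,x_n] (with R_0 = K). -/

import Mathlib

open MvPolynomial

/-- `p ∈ K[x_1,…,x_n]` lies in the subring `R_i = K[x_{n-i+1},…,x_n]` of
polynomials in the last `i` variables. -/
def InLast {K : Type*} [CommSemiring K] {n : ℕ} (i : ℕ)
    (p : MvPolynomial (Fin n) K) : Prop :=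
  ∀ d ∈ p.support, ∀ j : Fin n, (j : ℕ) < n - i → d j = 0

/-- The `K`-algebra endomorphism of `K[x_1,…,x_n]` given by the linear change
of coordinates with matrix `L`. -/
noncomputable def linChange {K : Type*} [CommRing K] {n : ℕ}
    (L : Matrix (Fin n) (Fin n) K) :
    MvPolynomial (Fin n) K →ₐ[K] MvPolynomial (Fin n) K :=
  aeval (fun t : Fin n => ∑ u : Fin n, L t u • (X u : MvPolynomial (Fin n) K))

section FreeDecomp

open DirectSum

variable {K : Type*} [Field K] {n : ℕ} {M : Type*} [AddCommGroup M] [Module K M]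
  [Module (MvPolynomial (Fin n) K) M]

/-- The variables `X t` with `s ≤ t < k`. -/
def varRange (n s k : ℕ) : Set (Fin n) := {t | s ≤ (t : ℕ) ∧ (t : ℕ) < k}

/-- `T / N` is a direct sum of finitely many free modules, each on a homogeneous generator `b j`
over the polynomial ring in the linear forms `linChange L (X t)` with `s j ≤ t < k`. -/
def FreeDecomp (ℳ : ℕ → Submodule K M) (L : Matrix (Fin n) (Fin n) K) (k : ℕ)
    (N T : Submodule (MvPolynomial (Fin n) K) M) : Prop :=
  ∃ (ι : Type) (_ : Fintype ι) (s deg : ι → ℕ) (b : ι → M),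
    (∀ j, s j ≤ k) ∧ (∀ j, b j ∈ ℳ (deg j)) ∧ (∀ j, b j ∈ T) ∧
    (∀ m ∈ T, ∃ c : ι → MvPolynomial (Fin n) K,
      (∀ j, c j ∈ supported K (varRange n (s j) k)) ∧
      m - ∑ j, linChange L (c j) • b j ∈ N) ∧
    (∀ c : ι → MvPolynomial (Fin n) K, (∀ j, c j ∈ supported K (varRange n (s j) k)) →
      ∑ j, linChange L (c j) • b j ∈ N → ∀ j, c j = 0)

/-- The linear form with coefficient vector `v`. -/
noncomputable def linForm : (Fin n → K) →ₗ[K] MvPolynomial (Fin n) K :=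
  Fintype.linearCombination K X

theorem linChange_X (L : Matrix (Fin n) (Fin n) K) (t : Fin n) :
    linChange L (X t) = linForm (L t) := by
  simp [linChange, linForm, Fintype.linearCombination_apply]

theorem isHomogeneous_linForm (v : Fin n → K) : (linForm v).IsHomogeneous 1 := by
  rw [linForm, Fintype.linearCombination_apply]
  refine IsHomogeneous.sum _ _ _ fun i _ => ?_
  rw [smul_eq_C_mul]
  simpa using (isHomogeneous_C (Fin n) (v i)).mul (isHomogeneous_X K i)

theorem linForm_single (t : Fin n) : linForm (Pi.single t (1 : K)) = X t := by
  simp [linForm, Fintype.linearCombination_apply_single]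

theorem mem_supported_iff_support {s : Set (Fin n)} {p : MvPolynomial (Fin n) K} :
    p ∈ supported K s ↔ ∀ d ∈ p.support, ∀ t ∉ s, d t = 0 := by
  rw [mem_supported]
  constructor
  · intro h d hd t ht
    by_contra h0
    exact ht (h (by simpa [mem_vars_iff_mem_support] using ⟨d, by simpa using hd, h0⟩))
  · intro h t ht
    rw [Finset.mem_coe, mem_vars_iff_mem_support] at ht
    obtain ⟨d, hd, hdt⟩ := ht
    by_contra hs
    exact (Finsupp.mem_support_iff.1 hdt) (h d hd t hs)

theorem homogeneousComponent_mem_supported {s : Set (Fin n)} {p : MvPolynomial (Fin n) K}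
    (hp : p ∈ supported K s) (e : ℕ) : homogeneousComponent e p ∈ supported K s := by
  rw [mem_supported_iff_support] at hp ⊢
  intro d hd
  refine hp d ?_
  rw [mem_support_iff, coeff_homogeneousComponent] at hd
  rw [mem_support_iff]
  intro h
  simp [h] at hd

theorem isHomogeneous_linChange (L : Matrix (Fin n) (Fin n) K) {p : MvPolynomial (Fin n) K}
    {e : ℕ} (hp : p.IsHomogeneous e) : (linChange L p).IsHomogeneous e := by
  have h := hp.aeval (fun t => linChange L (X t))
    (fun t => by rw [linChange_X]; exact isHomogeneous_linForm (L t))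
  rw [one_mul] at h
  simpa [linChange] using h

/-- Every polynomial in the variables `X t`, `s ≤ t < k + 1`, splits as a polynomial not
involving `X k` plus a multiple of `X k`. -/
theorem exists_eq_add_X_mul {s k : ℕ} (hk : k < n) {p : MvPolynomial (Fin n) K}
    (hp : p ∈ supported K (varRange n s (k + 1))) :
    ∃ q ∈ supported K (varRange n s (k + 1)), ∃ r ∈ supported K (varRange n s k),
      p = X ⟨k, hk⟩ * q + r := by
  set t : Fin n := ⟨k, hk⟩
  rw [mem_supported_iff_support] at hp
  have key : ∀ d, coeff d (p.divMonomial (Finsupp.single t 1)) = coeff (Finsupp.single t 1 + d) p :=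
    fun d => coeff_divMonomial _ _ _
  refine ⟨p.divMonomial (Finsupp.single t 1), ?_, p.modMonomial (Finsupp.single t 1), ?_,
    (divMonomial_add_modMonomial_single p t).symm⟩
  · rw [mem_supported_iff_support]
    intro d hd u hu
    rw [mem_support_iff, key, ← mem_support_iff] at hd
    have := hp _ hd u hu
    rw [Finsupp.add_apply] at this
    omega
  · rw [mem_supported_iff_support]
    intro d hd u hu
    rw [mem_support_iff] at hd
    by_cases hle : Finsupp.single t 1 ≤ d
    · exact absurd (coeff_modMonomial_of_le p hle) hd
    rw [coeff_modMonomial_of_not_le p hle, ← mem_support_iff] at hd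
    by_cases hut : u = t
    · subst hut
      rw [Finsupp.single_le_iff] at hle
      omega
    · refine hp d hd u fun h => hu ⟨h.1, ?_⟩
      have : (u : ℕ) ≠ k := fun h' => hut (Fin.ext h')
      have := h.2
      omega

variable {ℳ : ℕ → Submodule K M}

theorem smul_mem_of_isHomogeneous [IsScalarTower K (MvPolynomial (Fin n) K) M]
    (hgr : ∀ (d : Fin n →₀ ℕ) (σ : ℕ), ∀ m ∈ ℳ σ,
      (monomial d (1 : K) : MvPolynomial (Fin n) K) • m ∈ ℳ (σ + d.sum fun _ e => e))
    {p : MvPolynomial (Fin n) K} {e σ : ℕ} (hp : p.IsHomogeneous e) {m : M} (hm : m ∈ ℳ σ) :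
    p • m ∈ ℳ (σ + e) := by
  rw [p.as_sum, Finset.sum_smul]
  refine Submodule.sum_mem _ fun d hd => ?_
  have h1 : monomial d (coeff d p) = coeff d p • monomial d (1 : K) := by
    simp [smul_monomial]
  have h2 : (d.sum fun _ e => e) = e := (hp.degree_eq_sum_deg_support hd).symm
  rw [h1, smul_assoc, ← h2]
  exact Submodule.smul_mem _ _ (hgr d σ m hm)

variable [Decomposition ℳ]

theorem decompose_smul_succ
    {p : MvPolynomial (Fin n) K} (hp : ∀ σ, ∀ m ∈ ℳ σ, p • m ∈ ℳ (σ + 1)) (m : M) (d : ℕ) :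
    (decompose ℳ (p • m) (d + 1) : M) = p • (decompose ℳ m d : M) := by
  induction m using Decomposition.inductionOn ℳ with
  | zero => simp
  | @homogeneous i m =>
    by_cases h : i = d
    · subst h
      rw [decompose_of_mem_same ℳ (hp _ _ m.2), decompose_of_mem_same ℳ m.2]
    · rw [decompose_of_mem_ne ℳ (hp _ _ m.2) (by omega), decompose_of_mem_ne ℳ m.2 h, smul_zero]
  | add m m' h h' => simp [smul_add, decompose_add, h, h']

theorem decompose_smul_zero
    {p : MvPolynomial (Fin n) K} (hp : ∀ σ, ∀ m ∈ ℳ σ, p • m ∈ ℳ (σ + 1)) (m : M) :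
    (decompose ℳ (p • m) 0 : M) = 0 := by
  induction m using Decomposition.inductionOn ℳ with
  | zero => simp
  | @homogeneous i m => rw [decompose_of_mem_ne ℳ (hp _ _ m.2) (by omega)]
  | add m m' h h' => simp [smul_add, decompose_add, h, h']

theorem mem_of_decompose_mem {S : Type*} [SetLike S M] [AddSubmonoidClass S M] {Q : S} {m : M}
    (h : ∀ d, (decompose ℳ m d : M) ∈ Q) : m ∈ Q := by
  classical
  rw [← sum_support_decompose ℳ m]
  exact sum_mem fun d _ => h d

theorem isHomogeneous_sup_of_smul {p : MvPolynomial (Fin n) K}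
    (hp : ∀ σ, ∀ m ∈ ℳ σ, p • m ∈ ℳ (σ + 1)) {T : Submodule (MvPolynomial (Fin n) K) M}
    (hT : SetLike.IsHomogeneous ℳ T) :
    SetLike.IsHomogeneous ℳ (T ⊔ LinearMap.range (LinearMap.lsmul _ M p)) := by
  intro d m hm
  obtain ⟨x, hx, _, ⟨y, rfl⟩, rfl⟩ := Submodule.mem_sup.1 hm
  rw [decompose_add, DirectSum.add_apply, Submodule.coe_add]
  refine Submodule.add_mem_sup (hT d hx) ?_
  rw [LinearMap.lsmul_apply]
  cases d with
  | zero => rw [decompose_smul_zero hp]; exact Submodule.zero_mem _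
  | succ d => rw [decompose_smul_succ hp]; exact ⟨_, rfl⟩

/-- Graded Nakayama: a homogeneous subspace `Q` stable under an operator `p` of degree one is
everything as soon as `Q + p M = M`. -/
theorem mem_of_forall_exists_smul {p : MvPolynomial (Fin n) K}
    (hp : ∀ σ, ∀ m ∈ ℳ σ, p • m ∈ ℳ (σ + 1)) {Q : AddSubmonoid M}
    (hQ : SetLike.IsHomogeneous ℳ Q) (hpQ : ∀ m ∈ Q, p • m ∈ Q)
    (h : ∀ m : M, ∃ q ∈ Q, ∃ m', m = q + p • m') (m : M) : m ∈ Q := by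
  refine mem_of_decompose_mem (ℳ := ℳ) fun d => ?_
  induction d generalizing m with
  | zero =>
    obtain ⟨q, hq, m', rfl⟩ := h m
    rw [decompose_add, DirectSum.add_apply, Submodule.coe_add, decompose_smul_zero hp, add_zero]
    exact hQ _ hq
  | succ d ih =>
    obtain ⟨q, hq, m', rfl⟩ := h m
    rw [decompose_add, DirectSum.add_apply, Submodule.coe_add, decompose_smul_succ hp]
    exact add_mem (hQ _ hq) (hpQ _ (ih m'))

omit [Decomposition ℳ] in
theorem FreeDecomp.refl (L : Matrix (Fin n) (Fin n) K) (k : ℕ)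
    (N : Submodule (MvPolynomial (Fin n) K) M) : FreeDecomp ℳ L k N N :=
  ⟨Empty, inferInstance, Empty.elim, Empty.elim, Empty.elim, by simp, by simp, by simp,
    fun m hm => ⟨Empty.elim, by simp, by simpa using hm⟩, by simp⟩

omit [Decomposition ℳ] in
theorem FreeDecomp.trans {L : Matrix (Fin n) (Fin n) K} {k : ℕ}
    {N T P : Submodule (MvPolynomial (Fin n) K) M} (hNT : N ≤ T) (hTP : T ≤ P)
    (h₁ : FreeDecomp ℳ L k N T) (h₂ : FreeDecomp ℳ L k T P) : FreeDecomp ℳ L k N P := by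
  obtain ⟨ι₁, _, s₁, deg₁, b₁, hs₁, hb₁, hT₁, hsp₁, hin₁⟩ := h₁
  obtain ⟨ι₂, _, s₂, deg₂, b₂, hs₂, hb₂, hT₂, hsp₂, hin₂⟩ := h₂
  refine ⟨ι₁ ⊕ ι₂, inferInstance, Sum.elim s₁ s₂, Sum.elim deg₁ deg₂, Sum.elim b₁ b₂,
    Sum.rec hs₁ hs₂, Sum.rec hb₁ hb₂, Sum.rec (fun j => hTP (hT₁ j)) hT₂, ?_, ?_⟩
  · intro m hm
    obtain ⟨c₂, hc₂, hm₂⟩ := hsp₂ m hm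
    obtain ⟨c₁, hc₁, hm₁⟩ := hsp₁ _ hm₂
    refine ⟨Sum.elim c₁ c₂, Sum.rec hc₁ hc₂, ?_⟩
    simpa [sub_sub, add_comm] using hm₁
  · intro c hc h
    rw [Fintype.sum_sum_type] at h
    simp only [Sum.elim_inl, Sum.elim_inr] at h
    have h1 : ∑ j, linChange L (c (Sum.inl j)) • b₁ j ∈ T :=
      Submodule.sum_mem _ fun j _ => Submodule.smul_mem _ _ (hT₁ j)
    have e2 := hin₂ (fun j => c (Sum.inr j)) (fun j => hc (Sum.inr j))
      ((Submodule.add_mem_iff_right _ h1).1 (hNT h))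
    have e1 := hin₁ (fun j => c (Sum.inl j)) (fun j => hc (Sum.inl j)) (by simpa [e2] using h)
    exact Sum.rec e1 e2

omit [Decomposition ℳ] in
theorem smul_sub_coeff_zero_smul_mem [IsScalarTower K (MvPolynomial (Fin n) K) M]
    {T : Submodule (MvPolynomial (Fin n) K) M} {m : M}
    (hX : ∀ t : Fin n, (X t : MvPolynomial (Fin n) K) • m ∈ T) (p : MvPolynomial (Fin n) K) :
    p • m - coeff 0 p • m ∈ T := by
  induction p using MvPolynomial.induction_on with
  | C a => rw [← algebraMap_eq, algebraMap_smul, algebraMap_eq]; simp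
  | add p q hp hq =>
    simpa only [coeff_add, add_smul, add_sub_add_comm] using T.add_mem hp hq
  | mul_X p t _ =>
    have : coeff 0 (p * X t) = 0 := by simp [coeff_mul_X']
    simpa [this, mul_smul] using T.smul_mem p (hX t)

theorem isHomogeneous_sup_span_singleton [IsScalarTower K (MvPolynomial (Fin n) K) M]
    {T : Submodule (MvPolynomial (Fin n) K) M} (hT : SetLike.IsHomogeneous ℳ T)
    {m : M} {d : ℕ} (hm : m ∈ ℳ d)
    (hX : ∀ t : Fin n, (X t : MvPolynomial (Fin n) K) • m ∈ T) :
    SetLike.IsHomogeneous ℳ (T ⊔ Submodule.span (MvPolynomial (Fin n) K) {m}) := by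
  intro e y hy
  obtain ⟨x, hx, z, hz, rfl⟩ := Submodule.mem_sup.1 hy
  obtain ⟨p, rfl⟩ := Submodule.mem_span_singleton.1 hz
  have hpm : coeff 0 p • m ∈ ℳ d := Submodule.smul_mem _ _ hm
  have hxp : x + p • m = x + (p • m - coeff 0 p • m) + coeff 0 p • m := by abel
  rw [hxp, decompose_add, DirectSum.add_apply, Submodule.coe_add]
  refine add_mem (Submodule.mem_sup_left
    (hT e (T.add_mem hx (smul_sub_coeff_zero_smul_mem hX p)))) (Submodule.mem_sup_right ?_)
  by_cases hde : d = e
  · subst hde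
    rw [decompose_of_mem_same ℳ hpm, ← algebraMap_smul (MvPolynomial (Fin n) K)]
    exact Submodule.smul_mem _ _ (Submodule.mem_span_singleton_self m)
  · rw [decompose_of_mem_ne ℳ hpm hde]
    exact Submodule.zero_mem _

omit [Decomposition ℳ] in
/-- Adjoining a homogeneous element killed by all variables modulo `T`. -/
theorem FreeDecomp.sup_span_singleton [IsScalarTower K (MvPolynomial (Fin n) K) M]
    (L : Matrix (Fin n) (Fin n) K) (k : ℕ)
    {T : Submodule (MvPolynomial (Fin n) K) M} {m : M} {d : ℕ} (hm : m ∈ ℳ d) (hmT : m ∉ T)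
    (hX : ∀ t : Fin n, (X t : MvPolynomial (Fin n) K) • m ∈ T) :
    FreeDecomp ℳ L k T (T ⊔ Submodule.span _ {m}) := by
  have hvr : varRange n k k = ∅ := by
    ext t; simp [varRange]
  have hC : ∀ a : K, linChange L (C a) • m = a • m := by
    intro a
    rw [← algebraMap_eq, AlgHom.commutes, algebraMap_smul]
  refine ⟨Unit, inferInstance, fun _ => k, fun _ => d, fun _ => m, by simp, by simpa using hm,
    fun _ => Submodule.mem_sup_right (Submodule.mem_span_singleton_self m), ?_, ?_⟩
  · intro x hx
    obtain ⟨y, hy, z, hz, rfl⟩ := Submodule.mem_sup.1 hx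
    obtain ⟨p, rfl⟩ := Submodule.mem_span_singleton.1 hz
    refine ⟨fun _ => C (coeff 0 p), fun _ => Subalgebra.algebraMap_mem _ _, ?_⟩
    simp only [Finset.univ_unique, Finset.sum_const, Finset.card_singleton, one_smul, hC]
    rw [add_sub_assoc]
    exact T.add_mem hy (smul_sub_coeff_zero_smul_mem hX p)
  · intro c hc h j
    have := hc j
    rw [hvr, supported_empty, Algebra.mem_bot] at this
    obtain ⟨a, ha⟩ := this
    have hcj : c () = C a := ha.symm
    simp only [Finset.univ_unique, Finset.sum_singleton] at h
    change linChange L (c ()) • m ∈ T at h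
    rw [hcj, hC] at h
    by_cases ha0 : a = 0
    · subst ha0; simpa using hcj
    · refine absurd ?_ hmT
      have := T.smul_mem (C a⁻¹) h
      rw [← algebraMap_eq, algebraMap_smul, smul_smul, inv_mul_cancel₀ ha0, one_smul] at this
      exact this

/-- Lifting a decomposition along a form `linForm (L k)` that is regular modulo `T`. -/
theorem FreeDecomp.lift [IsScalarTower K (MvPolynomial (Fin n) K) M]
    (hgr : ∀ (d : Fin n →₀ ℕ) (σ : ℕ), ∀ m ∈ ℳ σ,
      (monomial d (1 : K) : MvPolynomial (Fin n) K) • m ∈ ℳ (σ + d.sum fun _ e => e))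
    {L : Matrix (Fin n) (Fin n) K} {k : ℕ} (hk : k < n)
    {T : Submodule (MvPolynomial (Fin n) K) M} (hT : SetLike.IsHomogeneous ℳ T)
    (hreg : ∀ m : M, linForm (L ⟨k, hk⟩) • m ∈ T → m ∈ T)
    (h : FreeDecomp ℳ L k (T ⊔ LinearMap.range (LinearMap.lsmul _ M (linForm (L ⟨k, hk⟩)))) ⊤) :
    FreeDecomp ℳ L (k + 1) T ⊤ := by
  obtain ⟨ι, _, s, deg, b, hs, hb, -, hsp, hin⟩ := h
  have hmono : ∀ j, supported K (varRange n (s j) k) ≤ supported K (varRange n (s j) (k + 1)) :=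
    fun j => supported_mono fun t ht => ⟨ht.1, ht.2.trans (Nat.lt_succ_self k)⟩
  have hp : ∀ σ, ∀ m ∈ ℳ σ, linForm (L ⟨k, hk⟩) • m ∈ ℳ (σ + 1) :=
    fun σ m hm => smul_mem_of_isHomogeneous hgr (isHomogeneous_linForm _) hm
  refine ⟨ι, inferInstance, s, deg, b, fun j => (hs j).trans (Nat.le_succ k), hb, by simp, ?_, ?_⟩
  · let Q : AddSubmonoid M :=
      { carrier := {m | ∃ c : ι → MvPolynomial (Fin n) K,
          (∀ j, c j ∈ supported K (varRange n (s j) (k + 1))) ∧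
          m - ∑ j, linChange L (c j) • b j ∈ T}
        zero_mem' := ⟨0, fun j => Subalgebra.zero_mem _, by simp⟩
        add_mem' := by
          rintro x y ⟨c, hc, hx⟩ ⟨c', hc', hy⟩
          refine ⟨c + c', fun j => Subalgebra.add_mem _ (hc j) (hc' j), ?_⟩
          simpa [add_smul, Finset.sum_add_distrib, add_sub_add_comm] using T.add_mem hx hy }
    have hTQ : ∀ m ∈ T, m ∈ Q := fun m hm => ⟨0, fun j => Subalgebra.zero_mem _, by simpa using hm⟩
    have hbQ : ∀ j, ∀ p ∈ supported K (varRange n (s j) (k + 1)), linChange L p • b j ∈ Q := by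
      classical
      intro j p hpj
      refine ⟨Pi.single j p, fun i => ?_, ?_⟩
      · by_cases hij : i = j
        · subst hij; simpa using hpj
        · simp [hij]
      · rw [Finset.sum_eq_single j (by intro i _ hij; simp [hij]) (by simp)]
        simp
    have hQ : SetLike.IsHomogeneous ℳ Q := by
      rintro d m ⟨c, hc, hm⟩
      have hmon : ∀ j e, linChange L (homogeneousComponent e (c j)) • b j ∈ ℳ (deg j + e) :=
        fun j e => smul_mem_of_isHomogeneous hgr
          (isHomogeneous_linChange L (homogeneousComponent_isHomogeneous _ _)) (hb j)
      have hj : ∀ j, (decompose ℳ (linChange L (c j) • b j) d : M) ∈ Q := by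
        intro j
        rw [← sum_homogeneousComponent (c j), map_sum, Finset.sum_smul, decompose_sum,
          DFinsupp.finsetSum_apply, AddSubmonoidClass.coe_finsetSum]
        refine sum_mem fun e _ => ?_
        by_cases hde : deg j + e = d
        · subst hde
          rw [decompose_of_mem_same ℳ (hmon j e)]
          exact hbQ j _ (homogeneousComponent_mem_supported (hc j) e)
        · rw [decompose_of_mem_ne ℳ (hmon j e) hde]
          exact zero_mem _
      rw [← sub_add_cancel m (∑ j, linChange L (c j) • b j), decompose_add, DirectSum.add_apply,
        Submodule.coe_add, decompose_sum, DFinsupp.finsetSum_apply,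
        AddSubmonoidClass.coe_finsetSum]
      exact add_mem (hTQ _ (hT d hm)) (sum_mem fun j _ => hj j)
    have hpQ : ∀ m ∈ Q, linForm (L ⟨k, hk⟩) • m ∈ Q := by
      rintro m ⟨c, hc, hm⟩
      refine ⟨fun j => X ⟨k, hk⟩ * c j, fun j => Subalgebra.mul_mem _ ?_ (hc j), ?_⟩
      · exact X_mem_supported.2 ⟨hs j, Nat.lt_succ_self k⟩
      · simpa [linChange_X, mul_smul, ← Finset.smul_sum, ← smul_sub] using T.smul_mem _ hm
    refine fun m _ => mem_of_forall_exists_smul hp hQ hpQ (fun m => ?_) m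
    obtain ⟨c, hc, hm⟩ := hsp m trivial
    obtain ⟨x, hx, _, ⟨y, rfl⟩, hxy⟩ := Submodule.mem_sup.1 hm
    refine ⟨x + ∑ j, linChange L (c j) • b j,
      add_mem (hTQ x hx) (sum_mem fun j _ => hbQ j _ (hmono j (hc j))), y, ?_⟩
    rw [LinearMap.lsmul_apply] at hxy
    rw [add_right_comm, hxy, sub_add_cancel]
  · have main : ∀ e, ∀ c : ι → MvPolynomial (Fin n) K, (∀ j, c j = 0 ∨ (c j).totalDegree < e) →
        (∀ j, c j ∈ supported K (varRange n (s j) (k + 1))) →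
        ∑ j, linChange L (c j) • b j ∈ T → ∀ j, c j = 0 := by
      have split : ∀ c : ι → MvPolynomial (Fin n) K,
          (∀ j, c j ∈ supported K (varRange n (s j) (k + 1))) →
          ∑ j, linChange L (c j) • b j ∈ T → ∃ q : ι → MvPolynomial (Fin n) K,
          (∀ j, q j ∈ supported K (varRange n (s j) (k + 1))) ∧
          (∀ j, c j = X ⟨k, hk⟩ * q j) ∧
          ∑ j, linChange L (q j) • b j ∈ T := by
        intro c hc h
        choose q hq r hr hcqr using fun j => exists_eq_add_X_mul hk (hc j)
        have hsum : ∑ j, linChange L (c j) • b j =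
            linForm (L ⟨k, hk⟩) • ∑ j, linChange L (q j) • b j + ∑ j, linChange L (r j) • b j := by
          rw [Finset.smul_sum, ← Finset.sum_add_distrib]
          refine Finset.sum_congr rfl fun j _ => ?_
          rw [hcqr j, map_add, map_mul, linChange_X, add_smul, mul_smul]
        have hr0 : ∀ j, r j = 0 := by
          refine hin r hr ?_
          have : ∑ j, linChange L (r j) • b j = ∑ j, linChange L (c j) • b j +
              LinearMap.lsmul _ M (linForm (L ⟨k, hk⟩)) (-∑ j, linChange L (q j) • b j) := by
            rw [hsum, LinearMap.lsmul_apply, smul_neg]; abel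
          rw [this]
          exact Submodule.add_mem_sup h ⟨_, rfl⟩
        refine ⟨q, hq, fun j => by rw [hcqr j, hr0 j, add_zero], hreg _ ?_⟩
        simpa [hsum, hr0] using h
      intro e
      induction e with
      | zero => exact fun c hd _ _ j => (hd j).resolve_right (Nat.not_lt_zero _)
      | succ e ih =>
        intro c hd hc h
        obtain ⟨q, hq, hcq, hqT⟩ := split c hc h
        have hlt : ∀ j, q j = 0 ∨ (q j).totalDegree < e := fun j => by
          refine or_iff_not_imp_left.2 fun h0 => ?_
          have := (hd j).resolve_left (by rw [hcq j]; exact mul_ne_zero (X_ne_zero _) h0)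
          rw [hcq j, totalDegree_mul_of_isDomain (X_ne_zero _) h0, totalDegree_X] at this
          omega
        intro j
        rw [hcq j, ih q hlt hq hqT j, mul_zero]
    exact fun c hc h => main (Finset.univ.sup (fun j => (c j).totalDegree) + 1) c
      (fun j => Or.inr (Nat.lt_succ_of_le
        (Finset.le_sup (f := fun j => (c j).totalDegree) (Finset.mem_univ j)))) hc h

/-- Every homogeneous submodule `N` is contained in a homogeneous submodule `T` such that `T / N`
is finite-dimensional and no nonzero element of `M / T` is killed by all variables. -/
theorem exists_saturation [IsScalarTower K (MvPolynomial (Fin n) K) M]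
    [Module.Finite (MvPolynomial (Fin n) K) M]
    (hgr : ∀ (d : Fin n →₀ ℕ) (σ : ℕ), ∀ m ∈ ℳ σ,
      (monomial d (1 : K) : MvPolynomial (Fin n) K) • m ∈ ℳ (σ + d.sum fun _ e => e))
    (k : ℕ) {N : Submodule (MvPolynomial (Fin n) K) M} (hN : SetLike.IsHomogeneous ℳ N) :
    ∃ T, N ≤ T ∧ SetLike.IsHomogeneous ℳ T ∧ (∀ L, FreeDecomp ℳ L k N T) ∧
      ∀ m : M, (∀ t : Fin n, (X t : MvPolynomial (Fin n) K) • m ∈ T) → m ∈ T := by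
  have hX : ∀ t : Fin n, ∀ σ, ∀ m ∈ ℳ σ, (X t : MvPolynomial (Fin n) K) • m ∈ ℳ (σ + 1) :=
    fun t σ m hm => smul_mem_of_isHomogeneous hgr (isHomogeneous_X K t) hm
  obtain ⟨T, ⟨hNT, hT, hfree⟩, hmax⟩ := set_has_maximal_iff_noetherian.2
    (inferInstance : IsNoetherian (MvPolynomial (Fin n) K) M)
    {T | N ≤ T ∧ SetLike.IsHomogeneous ℳ T ∧ ∀ L, FreeDecomp ℳ L k N T}
    ⟨N, le_rfl, hN, fun L => FreeDecomp.refl L k N⟩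
  refine ⟨T, hNT, hT, hfree, fun m hm => mem_of_decompose_mem (ℳ := ℳ) fun d => ?_⟩
  by_contra hd
  set x : M := (decompose ℳ m d : M)
  have hxd : x ∈ ℳ d := (decompose ℳ m d).2
  have hx : ∀ t : Fin n, (X t : MvPolynomial (Fin n) K) • x ∈ T := fun t => by
    rw [← decompose_smul_succ (hX t)]
    exact hT _ (hm t)
  refine hmax (T ⊔ Submodule.span _ {x}) ⟨hNT.trans le_sup_left,
    isHomogeneous_sup_span_singleton hT hxd hx, fun L => (hfree L).trans hNT le_sup_left
      (FreeDecomp.sup_span_singleton L k hxd hd hx)⟩ (lt_of_le_of_ne le_sup_left fun h => hd ?_)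
  rw [h]
  exact Submodule.mem_sup_right (Submodule.mem_span_singleton_self x)

omit [Module K M] in
/-- Over an infinite field, there is a linear form outside a given proper subspace which is
regular modulo `T`, if no nonzero element of `M / T` is killed by all variables. -/
theorem exists_regular_linForm [Infinite K] [Module.Finite (MvPolynomial (Fin n) K) M]
    {T : Submodule (MvPolynomial (Fin n) K) M}
    (hT : ∀ m : M, (∀ t : Fin n, (X t : MvPolynomial (Fin n) K) • m ∈ T) → m ∈ T)
    {W : Submodule K (Fin n → K)} (hW : W ≠ ⊤) :
    ∃ v ∉ W, ∀ m : M, linForm v • m ∈ T → m ∈ T := by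
  have := (associatedPrimes.finite (MvPolynomial (Fin n) K) (M ⧸ T)).to_subtype
  let U : Option (associatedPrimes (MvPolynomial (Fin n) K) (M ⧸ T)) → Submodule K (Fin n → K) :=
    fun o => o.elim W fun p => (p.1.restrictScalars K).comap linForm
  have hU : ∀ o, U o ≠ ⊤ := by
    rintro (_ | ⟨p, hp⟩) h
    · exact hW h
    · have hXp : ∀ t, X t ∈ p := fun t => by
        have : Pi.single t (1 : K) ∈ U (some ⟨p, hp⟩) := h ▸ trivial
        rw [← linForm_single]
        exact this
      rw [AssociatedPrimes.mem_iff, isAssociatedPrime_iff] at hp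
      obtain ⟨hpr, x, rfl⟩ := hp
      obtain ⟨m, rfl⟩ := Submodule.Quotient.mk_surjective T x
      refine hpr.ne_top ?_
      have : m ∈ T := hT m fun t => by
        have := hXp t
        rw [Submodule.mem_colon_singleton, Submodule.mem_bot, ← Submodule.Quotient.mk_smul,
          Submodule.Quotient.mk_eq_zero] at this
        exact this
      rw [(Submodule.Quotient.mk_eq_zero T).2 this]
      simp
  have : ⋃ o, (U o : Set (Fin n → K)) ≠ Set.univ := fun h => by
    obtain ⟨o, ho⟩ := Subspace.exists_eq_top_of_iUnion_eq_univ h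
    exact hU o ho
  obtain ⟨v, hv⟩ := (Set.ne_univ_iff_exists_notMem _).1 this
  simp only [Set.mem_iUnion, not_exists] at hv
  refine ⟨v, hv none, fun m hm => ?_⟩
  by_contra hmT
  have hmem : linForm v ∈ ⋃ p ∈ associatedPrimes (MvPolynomial (Fin n) K) (M ⧸ T),
      (p : Set (MvPolynomial (Fin n) K)) := by
    rw [biUnion_associatedPrimes_eq_zero_divisors]
    refine ⟨Submodule.Quotient.mk m, by rwa [Ne, Submodule.Quotient.mk_eq_zero], ?_⟩
    rwa [← Submodule.Quotient.mk_smul, Submodule.Quotient.mk_eq_zero]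
  obtain ⟨p, hp, hvp⟩ := Set.mem_iUnion₂.1 hmem
  exact hv (some ⟨p, hp⟩) hvp

/-- If `M / N` is killed by the linearly independent linear forms `linForm (L t)`, `k ≤ t`, then
`L` can be completed to a basis for which `M / N` has a free decomposition. -/
theorem exists_freeDecomp [Infinite K] [IsScalarTower K (MvPolynomial (Fin n) K) M]
    [Module.Finite (MvPolynomial (Fin n) K) M]
    (hgr : ∀ (d : Fin n →₀ ℕ) (σ : ℕ), ∀ m ∈ ℳ σ,
      (monomial d (1 : K) : MvPolynomial (Fin n) K) • m ∈ ℳ (σ + d.sum fun _ e => e))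
    {k : ℕ} (hk : k ≤ n) {N : Submodule (MvPolynomial (Fin n) K) M}
    (hN : SetLike.IsHomogeneous ℳ N) (L : Matrix (Fin n) (Fin n) K)
    (hL : LinearIndepOn K L.row {t : Fin n | k ≤ (t : ℕ)})
    (hLN : ∀ t : Fin n, k ≤ (t : ℕ) → ∀ m : M, linForm (L t) • m ∈ N) :
    ∃ L' : Matrix (Fin n) (Fin n) K, (∀ t : Fin n, k ≤ (t : ℕ) → L' t = L t) ∧
      LinearIndependent K L'.row ∧ FreeDecomp ℳ L' k N ⊤ := by
  induction k generalizing N L with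
  | zero =>
    have hL' : LinearIndependent K L.row := by simpa using hL
    obtain ⟨T, hNT, -, hfree, hsat⟩ := exists_saturation hgr 0 hN
    refine ⟨L, fun _ _ => rfl, hL', ?_⟩
    have hall : ∀ (v : Fin n → K) (m : M), linForm v • m ∈ N := by
      intro v m
      have hv : v ∈ Submodule.span K (Set.range L.row) := by
        rw [hL'.span_eq_top_of_card_eq_finrank' (by simp)]; trivial
      induction hv using Submodule.span_induction with
      | mem x hx => obtain ⟨t, rfl⟩ := hx; exact hLN t (Nat.zero_le _) m
      | zero => simp
      | add x y _ _ hx hy => rw [map_add, add_smul]; exact N.add_mem hx hy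
      | smul a x _ hx =>
        rw [map_smul, smul_eq_C_mul, mul_smul]; exact N.smul_mem _ hx
    have hT : T = ⊤ := eq_top_iff.2 fun m _ => hsat m fun t => by
      rw [← linForm_single]
      exact hNT (hall _ m)
    exact hT ▸ hfree L
  | succ k ih =>
    obtain ⟨T, hNT, hT, hfree, hsat⟩ := exists_saturation hgr (k + 1) hN
    have hk' : k < n := hk
    let κ : Fin n := ⟨k, hk'⟩
    have hκ : κ ∉ {t : Fin n | k + 1 ≤ (t : ℕ)} := by simp [κ]
    have hset : {t : Fin n | k ≤ (t : ℕ)} = insert κ {t : Fin n | k + 1 ≤ (t : ℕ)} := by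
      ext t
      simp only [Set.mem_ofPred_eq, Set.mem_insert_iff, Fin.ext_iff, κ]
      omega
    have hW : Submodule.span K (L.row '' {t : Fin n | k + 1 ≤ (t : ℕ)}) ≠ ⊤ := by
      intro h
      classical
      have h1 := finrank_span_finset_le_card (R := K)
        ((Finset.univ.erase κ).image L.row)
      have h2 : L.row '' {t : Fin n | k + 1 ≤ (t : ℕ)} ⊆ ((Finset.univ.erase κ).image L.row) := by
        rintro _ ⟨t, ht, rfl⟩
        simp only [Finset.coe_image]
        refine ⟨t, ?_, rfl⟩
        simpa using fun h : t = κ => hκ (h ▸ ht)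
      have h3 := (Submodule.span_mono (R := K) h2)
      rw [h, top_le_iff] at h3
      rw [Set.finrank, h3, finrank_top, Module.finrank_fin_fun K] at h1
      have h4 := Finset.card_image_le (s := Finset.univ.erase κ) (f := L.row)
      rw [Finset.card_erase_of_mem (Finset.mem_univ _), Finset.card_univ, Fintype.card_fin] at h4
      omega
    obtain ⟨v, hvW, hreg⟩ := exists_regular_linForm hsat hW
    let L₁ : Matrix (Fin n) (Fin n) K := L.updateRow κ v
    have hL₁ : ∀ t : Fin n, k + 1 ≤ (t : ℕ) → L₁ t = L t := fun t ht =>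
      Function.update_of_ne (by rintro rfl; exact hκ ht) _ _
    have hL₁κ : L₁ κ = v := Function.update_self ..
    have himg : L₁.row '' {t : Fin n | k + 1 ≤ (t : ℕ)} = L.row '' {t : Fin n | k + 1 ≤ (t : ℕ)} :=
      Set.image_congr hL₁
    obtain ⟨L', hL', hind, hdec⟩ := ih hk'.le
      (isHomogeneous_sup_of_smul (p := linForm v)
        (fun σ m hm => smul_mem_of_isHomogeneous hgr (isHomogeneous_linForm v) hm) hT) L₁
      (by
        rw [hset, linearIndepOn_insert hκ, himg]
        exact ⟨hL.congr fun t ht => (hL₁ t ht).symm, show L₁ κ ∉ _ by rwa [hL₁κ]⟩)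
      (by
        intro t ht m
        by_cases htκ : t = κ
        · rw [htκ, hL₁κ]
          exact Submodule.mem_sup_right ⟨m, rfl⟩
        · have : k + 1 ≤ (t : ℕ) := by
            have : (t : ℕ) ≠ k := fun h => htκ (Fin.ext h)
            omega
          rw [hL₁ t this]
          exact Submodule.mem_sup_left (hNT (hLN t this m)))
    have hL'κ : L' κ = v := (hL' κ le_rfl).trans hL₁κ
    refine ⟨L', fun t ht => (hL' t (by omega)).trans (hL₁ t ht), hind, ?_⟩
    rw [← hL'κ] at hdec hreg
    exact (hfree L').trans hNT le_top (hdec.lift hgr hk' hT hreg)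

theorem inLast_iff_mem_supported {s : ℕ} {p : MvPolynomial (Fin n) K} :
    InLast (n - s) p ↔ p ∈ supported K (varRange n s n) := by
  rw [mem_supported_iff_support]
  refine forall₂_congr fun d _ => forall_congr' fun t => ?_
  have : (t : ℕ) < n - (n - s) ↔ t ∉ varRange n s n := by
    have := t.2
    simp only [varRange, Set.mem_ofPred_eq]
    omega
  rw [this]

end FreeDecomp

/-- **Existence of a filtered Stanley decomposition.**  Let `K` be an infinite
field and `M` a finitely generated graded module over `K[x_1,…,x_n]`.  Then
after a suitable invertible linear change of coordinates, `M` decomposes as a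
graded `K`-vector space `M = ⊕_{i=0}^n N_i`, where each `N_i` is a free
finitely generated graded module over `R_i = K[x_{n-i+1},…,x_n]`: there are
finitely many homogeneous elements `b_j ∈ M` (of degrees `deg j`, at levels
`lvl j ≤ n`) such that every `m ∈ M` is uniquely a sum `Σ_j φ(c_j) • b_j` with
`c_j ∈ R_{lvl j}`, `φ` the coordinate change. -/
theorem exists_filtered_stanley_decomposition {K : Type*} [Field K]
    [Infinite K] {n : ℕ}
    {M : Type*} [AddCommGroup M] [Module K M]
    [Module (MvPolynomial (Fin n) K) M]
    [IsScalarTower K (MvPolynomial (Fin n) K) M]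
    [Module.Finite (MvPolynomial (Fin n) K) M]
    (ℳ : ℕ → Submodule K M) [DirectSum.Decomposition ℳ]
    (hgr : ∀ (d : Fin n →₀ ℕ) (σ : ℕ), ∀ m ∈ ℳ σ,
      (monomial d (1 : K) : MvPolynomial (Fin n) K) • m ∈
        ℳ (σ + d.sum fun _ e => e)) :
    ∃ L : Matrix (Fin n) (Fin n) K, IsUnit L.det ∧
    ∃ (N : ℕ) (lvl : Fin N → ℕ) (_ : ∀ j, lvl j ≤ n)
      (deg : Fin N → ℕ) (b : Fin N → M),
      (∀ j, b j ∈ ℳ (deg j)) ∧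
      (∀ m : M, ∃ c : Fin N → MvPolynomial (Fin n) K,
        (∀ j, InLast (lvl j) (c j)) ∧
        m = ∑ j, (linChange L (c j)) • b j) ∧
      (∀ c : Fin N → MvPolynomial (Fin n) K,
        (∀ j, InLast (lvl j) (c j)) →
        ∑ j, (linChange L (c j)) • b j = 0 → ∀ j, c j = 0) := by
  obtain ⟨L, -, hind, ι, _, s, deg, b, -, hb, -, hsp, hin⟩ := exists_freeDecomp hgr le_rfl
    (N := ⊥) (fun d m hm => by simp_all) (1 : Matrix (Fin n) (Fin n) K)
    (by
      have : {t : Fin n | n ≤ (t : ℕ)} = ∅ := by ext t; simp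
      rw [this]
      exact linearIndepOn_empty K _)
    (fun t ht => absurd t.2 (by omega))
  let e := Fintype.equivFin ι
  refine ⟨L, (Matrix.isUnit_iff_isUnit_det L).1 (Matrix.linearIndependent_rows_iff_isUnit.1 hind),
    Fintype.card ι, fun j => n - s (e.symm j), fun j => Nat.sub_le _ _, fun j => deg (e.symm j),
    fun j => b (e.symm j), fun j => hb _, fun m => ?_, fun c hc h => ?_⟩
  · obtain ⟨c, hc, hm⟩ := hsp m trivial
    refine ⟨fun j => c (e.symm j), fun j => inLast_iff_mem_supported.2 (hc _), ?_⟩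
    rw [e.symm.sum_comp fun j => linChange L (c j) • b j]
    exact sub_eq_zero.1 hm
  · have := hin (fun j => c (e j))
      (fun j => inLast_iff_mem_supported.1 (by simpa using hc (e j)))
      (by
        rw [← e.symm.sum_comp]
        simpa using h)
    exact fun j => by simpa using this (e.symm j)
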